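/- Let G be a countable infinite amenable group, K a compact metrizable space of finite topological dimension, and X ⊆ K^G a closed subshift. Then mdim(X, G) ≤ liminf_{n→∞} dim(π_{F_n}(X))/|F_n| for every Følner sequence {F_n} of G, where π_E : K^G → K^E is the coordinate projection. -/

import Mathlib

open Filter Topology Pointwise ENNReal

/-- A Følner sequence for a group `G`. -/
def IsFolnerSeq (G : Type*) [Group G] (F : ℕ → Finset G) : Prop :=
  (∀ n, (F n).Nonempty) ∧
    ∀ g : G, Filter.Tendsto
      (fun n => ((symmDiff (g • ((F n) : Set G)) ((F n) : Set G)).ncard : ℝ) / (F n).card)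
      Filter.atTop (nhds 0)

/-- A group is amenable if it admits a Følner sequence. -/
def IsAmenable (G : Type*) [Group G] : Prop := ∃ F : ℕ → Finset G, IsFolnerSeq G F

variable {G : Type*} [Group G]

/-- The `K`-boundary of a finite set `A`. -/
def kBoundary (A K : Finset G) : Set G :=
  {g : G | (∃ k ∈ K, k * g ∈ A) ∧ ∃ k ∈ K, k * g ∉ A}

/-- `A` is `(K, δ)`-invariant. -/
def InvariantSet (A K : Finset G) (δ : ℝ) : Prop :=
  ((kBoundary A K).ncard : ℝ) < δ * A.card

/-- A subset of a group is syndetic if finitely many translates cover the group. -/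
def Syndetic (A : Set G) : Prop := ∃ F : Finset G, (F : Set G) * A = Set.univ

/-- A finite tiling of a group `G`: a partition of `G` into right translates of
finitely many finite shapes, each shape containing the identity. -/
structure FiniteTiling (G : Type*) [Group G] where
  tiles : Set (Set G)
  shapes : Finset (Finset G)
  covers : ∀ g : G, ∃! t, t ∈ tiles ∧ g ∈ t
  tile_shape : ∀ t ∈ tiles, ∃ S ∈ shapes, ∃ c : G, t = (S : Set G) * {c}
  one_mem_shape : ∀ S ∈ shapes, (1 : G) ∈ S

/-- The set of centers of a shape `S` in a tiling. -/
def FiniteTiling.center (T : FiniteTiling G) (S : Finset G) : Set G :=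
  {c : G | ((S : Set G) * {c}) ∈ T.tiles}

/-- A finite tiling is irreducible if every sufficiently invariant finite set
contains a tile of every shape. -/
def FiniteTiling.IsIrreducible (T : FiniteTiling G) : Prop :=
  ∃ (T₀ : Finset G) (ε : ℝ), 0 < ε ∧
    ∀ F : Finset G, InvariantSet F T₀ ε →
      ∀ S ∈ T.shapes, ∃ c ∈ T.center S, (S : Set G) * {c} ⊆ (F : Set G)

/-- The shift action of `G` on `A^G`: `(c • x) g = x (g * c)`. -/
def shiftAct {A : Type*} (c : G) (x : G → A) : G → A := fun g => x (g * c)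

instance : TopologicalSpace (Option (Finset G)) := ⊥

open Classical in
/-- The point of `(S(T) ∪ {0})^G` encoding the centers of a tiling. -/
noncomputable def FiniteTiling.point (T : FiniteTiling G) : G → Option (Finset G) :=
  fun g => if h : ∃ S, S ∈ T.shapes ∧ g ∈ T.center S then some h.choose else none

/-- The subshift associated with a finite tiling: the orbit closure of `T.point`. -/
noncomputable def FiniteTiling.subshift (T : FiniteTiling G) : Set (G → Option (Finset G)) :=
  closure (Set.range fun c : G => shiftAct c T.point)

/-- `T₂` is primely congruent with `T₁`: tiles of `T₂` are unions of tiles of `T₁`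
and each shape of `T₂` has a unique master partition by tiles of `T₁`. -/
def PrimelyCongruent (T₁ T₂ : FiniteTiling G) : Prop :=
  (∀ t₁ ∈ T₁.tiles, ∀ t₂ ∈ T₂.tiles, (t₁ ∩ t₂).Nonempty → t₁ ⊆ t₂) ∧
  ∀ S ∈ T₂.shapes, ∀ c c' : G, c ∈ T₂.center S → c' ∈ T₂.center S →
    {u : Set G | ∃ t ∈ T₁.tiles, t ⊆ (S : Set G) * {c} ∧ u = t * {c⁻¹}} =
    {u : Set G | ∃ t ∈ T₁.tiles, t ⊆ (S : Set G) * {c'} ∧ u = t * {c'⁻¹}}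

/-- Number of patterns of a subshift on a finite window `F`. -/
noncomputable def patternCount {A : Type*} (X : Set (G → A)) (F : Finset G) : ℕ :=
  {p : ↑F → A | ∃ x ∈ X, ∀ g : ↑F, x (g : G) = p g}.ncard

section Dim

variable {Y : Type*} [TopologicalSpace Y]

/-- `β` is a finite open cover of the set `X`. -/
def IsOpenCoverOf (X : Set Y) (β : Finset (Set Y)) : Prop :=
  (∀ U ∈ β, IsOpen U) ∧ X ⊆ ⋃ U ∈ β, U

/-- The order of a finite cover on a set `X`. -/
noncomputable def ordOn (X : Set Y) (β : Finset (Set Y)) : ℕ :=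
  ⨆ y : X, ({U : Set Y | U ∈ β ∧ (y : Y) ∈ U}.ncard - 1)

/-- `D(α)`: minimal order among finite open covers of `X` refining `α`. -/
noncomputable def Dcov (X : Set Y) (α : Finset (Set Y)) : ℕ :=
  sInf {n | ∃ β : Finset (Set Y), IsOpenCoverOf X β ∧
    (∀ U ∈ β, ∃ V ∈ α, U ⊆ V) ∧ ordOn X β = n}

/-- The topological (covering) dimension of a subset `X` of a topological space. -/
noncomputable def topDim (X : Set Y) : ℕ∞ :=
  ⨆ α ∈ {α : Finset (Set Y) | IsOpenCoverOf X α}, (Dcov X α : ℕ∞)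

/-- The join `⋁_{g ∈ F} (σ g)⁻¹ α` of the pullbacks of a finite cover along an action. -/
noncomputable def FCover {H : Type*} (σ : H → Y → Y) (F : Finset H) (α : Finset (Set Y)) :
    Finset (Set Y) :=
  letI := Classical.decEq H
  letI := Classical.decEq (Set Y)
  (F.pi fun _ => α).image fun f => ⋂ g, ⋂ (h : g ∈ F), σ g ⁻¹' f g h

/-- Mean topological dimension of `X` with respect to an action `σ` of `G`,
computed along the Følner sequence `Fo`. -/
noncomputable def mdim {H : Type*} (σ : H → Y → Y) (X : Set Y) (Fo : ℕ → Finset H) : ℝ≥0∞ :=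
  ⨆ α ∈ {α : Finset (Set Y) | IsOpenCoverOf X α},
    Filter.limsup
      (fun n => (Dcov X (FCover σ (Fo n) α) : ℝ≥0∞) / ((Fo n).card : ℝ≥0∞))
      Filter.atTop

end Dim

/-- A polyhedron: a finite union of simplices (convex hulls of finite sets) in a
Euclidean space. -/
def IsPolyhedron {N : ℕ} (P : Set (EuclideanSpace ℝ (Fin N))) : Prop :=
  ∃ S : Finset (Finset (EuclideanSpace ℝ (Fin N))),
    P = ⋃ s ∈ S, convexHull ℝ (s : Set (EuclideanSpace ℝ (Fin N)))

/-- The upper (Banach) density of a subset of an amenable group. -/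
noncomputable def upperDensity (G : Type*) [Group G] (J : Set G) : ℝ :=
  sSup {r : ℝ | ∃ Fo : ℕ → Finset G, IsFolnerSeq G Fo ∧
    r = Filter.limsup (fun n => ((J ∩ (Fo n : Set G)).ncard : ℝ) / (Fo n).card) Filter.atTop}


section OrnsteinWeiss

open Classical in
/-- The number of elements of `D` that left multiplication by some `b ∈ B` moves out of `D`,
counted with multiplicity. -/
noncomputable def exitCount (B D : Finset G) : ℕ :=
  ∑ b ∈ B, (D.filter fun c => b * c ∉ D).card

open Classical in
theorem exitCount_union_le (B U V : Finset G) :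
    exitCount B (U ∪ V) ≤ exitCount B U + exitCount B V := by
  unfold exitCount
  rw [← Finset.sum_add_distrib]
  refine Finset.sum_le_sum fun b _ => (Finset.card_le_card ?_).trans (Finset.card_union_le _ _)
  intro c
  simp only [Finset.mem_filter, Finset.mem_union]
  tauto

theorem exitCount_map_mulRight (B D : Finset G) (c : G) :
    exitCount B (D.map (mulRightEmbedding c)) = exitCount B D := by
  classical
  unfold exitCount
  refine Finset.sum_congr rfl fun b _ => ?_
  rw [Finset.filter_map, Finset.card_map]
  congr 1
  refine Finset.filter_congr fun d _ => ?_
  simp [← mul_assoc]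

open Classical in
theorem card_filter_not_mem_mul_mem (b : G) (V U : Finset G) :
    ((V \ U).filter fun c => b * c ∈ U).card ≤ (U.filter fun c => b * c ∉ U).card := by
  set P := U.map (mulLeftEmbedding b⁻¹) with hP
  have hmem : ∀ c, c ∈ P ↔ b * c ∈ U := by
    intro c
    simp only [hP, Finset.mem_map, mulLeftEmbedding_apply]
    constructor
    · rintro ⟨u, hu, rfl⟩
      simpa using hu
    · intro h
      exact ⟨b * c, h, by simp⟩
  have hcard : P.card = U.card := Finset.card_map _
  have h1 : ((V \ U).filter fun c => b * c ∈ U) ⊆ P \ U := by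
    intro c
    simp only [Finset.mem_filter, Finset.mem_sdiff, hmem]
    tauto
  have h2 : (U.filter fun c => b * c ∉ U) = U \ P := by
    ext c
    simp only [Finset.mem_filter, Finset.mem_sdiff, hmem]
  rw [h2, ← Finset.card_sdiff_comm hcard]
  exact Finset.card_le_card h1

open Classical in
theorem exitCount_sdiff_le (B D U : Finset G) :
    exitCount B (D \ U) ≤ exitCount B D + exitCount B U := by
  unfold exitCount
  rw [← Finset.sum_add_distrib]
  refine Finset.sum_le_sum fun b _ => ?_
  refine le_trans (le_trans (Finset.card_le_card ?_) (Finset.card_union_le _ _))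
    (Nat.add_le_add_left (card_filter_not_mem_mul_mem b D U) _)
  intro c
  simp only [Finset.mem_filter, Finset.mem_union, Finset.mem_sdiff]
  tauto

theorem exitCount_mono {B B' : Finset G} (hB : B ⊆ B') (D : Finset G) :
    exitCount B D ≤ exitCount B' D :=
  Finset.sum_le_sum_of_subset hB

open Classical in
theorem card_le_card_filter_add_exitCount (T D : Finset G) :
    D.card ≤ (D.filter fun c => ∀ t ∈ T, t * c ∈ D).card + exitCount T D := by
  have h : D ⊆ (D.filter fun c => ∀ t ∈ T, t * c ∈ D) ∪
      T.biUnion fun t => D.filter fun c => t * c ∉ D := by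
    intro c hc
    simp only [Finset.mem_union, Finset.mem_filter, Finset.mem_biUnion]
    by_cases h : ∀ t ∈ T, t * c ∈ D
    · exact Or.inl ⟨hc, h⟩
    · push Not at h
      obtain ⟨t, ht, htc⟩ := h
      exact Or.inr ⟨t, ht, hc, htc⟩
  exact (Finset.card_le_card h).trans ((Finset.card_union_le _ _).trans
    (Nat.add_le_add_left Finset.card_biUnion_le _))

open Classical in
theorem card_mul_sdiff_le_exitCount (B D : Finset G) : ((B * D) \ D).card ≤ exitCount B D := by
  have h : (B * D) \ D ⊆
      B.biUnion fun b => (D.filter fun c => b * c ∉ D).map (mulLeftEmbedding b) := by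
    intro x
    simp only [Finset.mem_sdiff, Finset.mem_mul, Finset.mem_biUnion, Finset.mem_map,
      Finset.mem_filter, mulLeftEmbedding_apply]
    rintro ⟨⟨b, hb, c, hc, rfl⟩, hx⟩
    exact ⟨b, hb, c, ⟨hc, hx⟩, rfl⟩
  refine (Finset.card_le_card h).trans (Finset.card_biUnion_le.trans ?_)
  simp [exitCount]

theorem IsFolnerSeq.tendsto_exitCount {F : ℕ → Finset G} (hF : IsFolnerSeq G F) (B : Finset G) :
    Tendsto (fun n => (exitCount B (F n) : ℝ) / (F n).card) atTop (𝓝 0) := by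
  classical
  have h := tendsto_finsetSum B fun b _ => hF.2 b
  simp only [Finset.sum_const_zero] at h
  refine squeeze_zero (fun n => by positivity) (fun n => ?_) h
  rw [← Finset.sum_div]
  gcongr
  rw [exitCount, Nat.cast_sum]
  refine Finset.sum_le_sum fun b _ => ?_
  rw [← Finset.card_map (mulLeftEmbedding b), ← Set.ncard_coe_finset, Nat.cast_le]
  refine Set.ncard_le_ncard ?_ (((F n).finite_toSet.smul_set).symmDiff (F n).finite_toSet)
  intro x
  simp only [Finset.coe_map, Set.mem_image, Finset.mem_coe, Finset.mem_filter,
    mulLeftEmbedding_apply]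
  rintro ⟨c, ⟨hc, hbc⟩, rfl⟩
  exact Or.inl ⟨Set.smul_mem_smul_set hc, hbc⟩

theorem IsFolnerSeq.eventually_exitCount_le {F : ℕ → Finset G} (hF : IsFolnerSeq G F)
    (B : Finset G) {η : ℝ} (hη : 0 < η) :
    ∀ᶠ n in atTop, (exitCount B (F n) : ℝ) ≤ η * (F n).card := by
  filter_upwards [(hF.tendsto_exitCount B).eventually_lt_const hη] with n hn
  have : (0 : ℝ) < (F n).card := by exact_mod_cast (hF.1 n).card_pos
  exact ((div_lt_iff₀ this).1 hn).le

open Classical in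
/-- A maximal `ε`-disjoint family of right translates of `T` inside `D`; `U` is its union and
`r` the number of its members. -/
theorem exists_almost_disjoint_packing {h : Finset G → ℝ} (h_empty : h ∅ = 0)
    (h_union : ∀ A B, h (A ∪ B) ≤ h A + h B)
    (h_map : ∀ A c, h (A.map (mulRightEmbedding c)) ≤ h A)
    (B D : Finset G) {T : Finset G} (hT : T.Nonempty) {ε : ℝ} (hε₀ : 0 ≤ ε)
    (hε : ε < 1) :
    ∃ U ⊆ D, ∃ r : ℕ, r * ((1 - ε) * T.card) ≤ U.card ∧ h U ≤ r * h T ∧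
      exitCount B U ≤ r * exitCount B T ∧
      ε * (D.card - exitCount T D) ≤ U.card := by
  have hTpos : (0 : ℝ) < T.card := by exact_mod_cast hT.card_pos
  set good : Finset G → Prop := fun U => ∃ r : ℕ, r * ((1 - ε) * T.card) ≤ U.card ∧
    h U ≤ r * h T ∧ exitCount B U ≤ r * exitCount B T with hgood
  obtain ⟨U, hU, hmax⟩ := (D.powerset.filter good).exists_max_image Finset.card
    ⟨∅, by
      simp only [Finset.mem_filter, Finset.empty_mem_powerset, true_and, hgood]
      exact ⟨0, by simp, by simp [h_empty], by simp [exitCount]⟩⟩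
  obtain ⟨hUD, r, hr₁, hr₂, hr₃⟩ := Finset.mem_filter.1 hU
  rw [Finset.mem_powerset] at hUD
  refine ⟨U, hUD, r, hr₁, hr₂, hr₃, ?_⟩
  set I := D.filter fun c => ∀ t ∈ T, t * c ∈ D with hI
  have hbig : ∀ c ∈ I, ε * T.card ≤ ((T.filter fun t => t * c ∈ U).card : ℝ) := by
    intro c hc
    by_contra! hlt
    set V := T.map (mulRightEmbedding c) with hV
    have hVD : V ⊆ D := by
      intro x
      simp only [hV, Finset.mem_map, mulRightEmbedding_apply]
      rintro ⟨t, ht, rfl⟩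
      exact (Finset.mem_filter.1 hc).2 t ht
    have hinter : (V ∩ U).card = (T.filter fun t => t * c ∈ U).card := by
      rw [← Finset.card_map (mulRightEmbedding c) (s := T.filter _)]
      congr 1
      ext x
      simp only [hV, Finset.mem_inter, Finset.mem_map, Finset.mem_filter, mulRightEmbedding_apply]
      constructor
      · rintro ⟨⟨t, ht, rfl⟩, hx⟩
        exact ⟨t, ⟨ht, hx⟩, rfl⟩
      · rintro ⟨t, ⟨ht, hx⟩, rfl⟩
        exact ⟨⟨t, ht, rfl⟩, hx⟩
    have hcard : ((U ∪ V).card : ℝ) + (V ∩ U).card = U.card + T.card := by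
      rw [Finset.inter_comm]
      have := Finset.card_union_add_card_inter U V
      rw [show V.card = T.card from Finset.card_map _] at this
      exact_mod_cast this
    rw [hinter] at hcard
    have hstep : (U.card : ℝ) + (1 - ε) * T.card ≤ (U ∪ V).card := by linarith
    have hUV := hmax (U ∪ V) (Finset.mem_filter.2 ⟨Finset.mem_powerset.2
      (Finset.union_subset hUD hVD), r + 1, ?_, ?_, ?_⟩)
    · have h1 : ((U ∪ V).card : ℝ) ≤ U.card := by exact_mod_cast hUV
      nlinarith
    · push_cast
      linarith
    · push_cast
      linarith [h_union U V, h_map T c]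
    · have h1 := exitCount_union_le B U V
      rw [hV, exitCount_map_mulRight] at h1
      linarith
  have hcount : ∑ c ∈ I, (T.filter fun t => t * c ∈ U).card ≤ T.card * U.card := by
    have hswap : ∑ c ∈ I, (T.filter fun t => t * c ∈ U).card =
        ∑ t ∈ T, (I.filter fun c => t * c ∈ U).card := by
      simp only [Finset.card_filter]
      exact Finset.sum_comm
    rw [hswap, ← smul_eq_mul]
    refine Finset.sum_le_card_nsmul _ _ _ fun t _ => ?_
    refine Finset.card_le_card_of_injOn (fun c => t * c) ?_ (mul_right_injective t).injOn
    intro c hc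
    exact (Finset.mem_filter.1 hc).2
  have hlow : (I.card : ℝ) * (ε * T.card) ≤ T.card * U.card := by
    rw [← nsmul_eq_mul]
    refine (Finset.card_nsmul_le_sum I _ _ hbig).trans ?_
    exact_mod_cast hcount
  have hIU : ε * I.card ≤ U.card := by
    by_contra! hlt
    nlinarith
  have hDI : (D.card : ℝ) ≤ I.card + exitCount T D := by
    exact_mod_cast card_le_card_filter_add_exitCount T D
  nlinarith

open Classical in
/-- One improvement step: a bound `a` per element, up to boundary terms, is lowered by packing
translates of a single well-chosen finite set `T`. -/
theorem exists_improved_bound {h : Finset G → ℝ} (h_empty : h ∅ = 0)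
    (h_union : ∀ A B, h (A ∪ B) ≤ h A + h B)
    (h_map : ∀ A c, h (A.map (mulRightEmbedding c)) ≤ h A)
    {a M l κ ε η : ℝ} (hM : 0 ≤ M) (hκ : 0 ≤ κ) (hκa : κ ≤ a) (hε₀ : 0 ≤ ε) (hε : ε < 1)
    {B T : Finset G} (hbound : ∀ D, h D ≤ a * D.card + M * exitCount B D)
    (hT : T.Nonempty) (hhT : h T ≤ l * T.card) (hBT : exitCount B T ≤ η * T.card)
    (hparam : l + M * η ≤ (1 - ε) * (a - κ)) (D : Finset G) :
    h D ≤ (a - κ * ε) * D.card + κ * ε * exitCount T D + M * exitCount B D := by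
  obtain ⟨U, hUD, r, hr₁, hr₂, hr₃, hr₄⟩ :=
    exists_almost_disjoint_packing h_empty h_union h_map B D hT hε₀ hε
  have hr : (0 : ℝ) ≤ r := Nat.cast_nonneg r
  have hDU : h D ≤ h U + h (D \ U) := by
    simpa [Finset.union_sdiff_of_subset hUD] using h_union U (D \ U)
  have hcard : ((D \ U).card : ℝ) = D.card - U.card := by
    rw [Finset.card_sdiff_of_subset hUD, Nat.cast_sub (Finset.card_le_card hUD)]
  have hexit : (exitCount B (D \ U) : ℝ) ≤ exitCount B D + r * exitCount B T := by
    exact_mod_cast (exitCount_sdiff_le B D U).trans (Nat.add_le_add_left hr₃ _)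
  have hrest := hbound (D \ U)
  rw [hcard] at hrest
  have h1 : M * exitCount B (D \ U) ≤ M * (exitCount B D + r * (η * T.card)) := by
    gcongr
    exact hexit.trans (by gcongr)
  have h2 : r * h T ≤ r * (l * T.card) := by gcongr
  have h3 : r * T.card * (l + M * η) ≤ r * T.card * ((1 - ε) * (a - κ)) := by gcongr
  have h4 : r * ((1 - ε) * T.card) * (a - κ) ≤ U.card * (a - κ) :=
    mul_le_mul_of_nonneg_right hr₁ (by linarith)
  have h5 : κ * (ε * (D.card - exitCount T D)) ≤ κ * U.card := by gcongr
  linarith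

open Classical in
/-- The Ornstein–Weiss lemma: for an invariant subadditive set function, the averages along a
Følner sequence eventually do not exceed any bound they satisfy infinitely often. -/
theorem IsFolnerSeq.eventually_le_of_frequently_le {F : ℕ → Finset G} (hF : IsFolnerSeq G F)
    {h : Finset G → ℝ} (h_empty : h ∅ = 0)
    (h_union : ∀ A B, h (A ∪ B) ≤ h A + h B)
    (h_map : ∀ A c, h (A.map (mulRightEmbedding c)) ≤ h A)
    {C l ρ : ℝ} (hC : ∀ A, h A ≤ C * A.card) (hl : 0 ≤ l)
    (hfreq : ∃ᶠ n in atTop, h (F n) ≤ l * (F n).card) (hρ : 0 < ρ) :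
    ∀ᶠ n in atTop, h (F n) ≤ (l + 2 * ρ) * (F n).card := by
  set κ := ρ / 2 with hκ
  set ε := ρ / (4 * (l + ρ)) with hε
  have hε₀ : 0 < ε := by positivity
  have hεmul : ε * (l + ρ) = ρ / 4 := by
    rw [hε]
    field_simp
  have hε₁ : ε < 1 := by
    by_contra! hge
    nlinarith
  have hκε : 0 < κ * ε := by positivity
  have key : ∀ k : ℕ, ∃ B : Finset G, ∃ M : ℝ, 0 ≤ M ∧
      ∀ D, h D ≤ max (l + ρ) (C - k * (κ * ε)) * D.card + M * exitCount B D := by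
    intro k
    induction k with
    | zero =>
      refine ⟨∅, 0, le_rfl, fun D => (hC D).trans ?_⟩
      simp only [Nat.cast_zero, zero_mul, sub_zero, add_zero]
      gcongr
      exact le_max_right _ _
    | succ k ih =>
      obtain ⟨B, M, hM, hbound⟩ := ih
      set a := max (l + ρ) (C - k * (κ * ε)) with ha
      have hal : l + ρ ≤ a := le_max_left _ _
      have hη : 0 < ρ / (8 * (M + 1)) := by positivity
      obtain ⟨n, hn, hBn⟩ := (hfreq.and_eventually (hF.eventually_exitCount_le B hη)).exists
      have hMη : M * (ρ / (8 * (M + 1))) ≤ ρ / 8 := by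
        rw [mul_div_assoc', div_le_div_iff₀ (by positivity) (by positivity)]
        nlinarith
      have himp := exists_improved_bound h_empty h_union h_map hM (by positivity : 0 ≤ κ)
        (by linarith) hε₀.le hε₁ hbound (hF.1 n) hn hBn (by nlinarith)
      refine ⟨B ∪ F n, M + κ * ε, by positivity, fun D => (himp D).trans ?_⟩
      have hk : a - κ * ε ≤ max (l + ρ) (C - (k + 1 : ℕ) * (κ * ε)) := by
        push_cast
        rcases le_total (l + ρ) (C - k * (κ * ε)) with hle | hle
        · refine le_max_of_le_right ?_
          rw [ha, max_eq_right hle]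
          linarith
        · refine le_max_of_le_left ?_
          rw [ha, max_eq_left hle]
          linarith
      have h1 : (exitCount B D : ℝ) ≤ exitCount (B ∪ F n) D := by
        exact_mod_cast exitCount_mono Finset.subset_union_left D
      have h2 : (exitCount (F n) D : ℝ) ≤ exitCount (B ∪ F n) D := by
        exact_mod_cast exitCount_mono Finset.subset_union_right D
      have h3 := mul_le_mul_of_nonneg_right hk (Nat.cast_nonneg (α := ℝ) D.card)
      have h4 := mul_le_mul_of_nonneg_left h1 hM
      have h5 := mul_le_mul_of_nonneg_left h2 hκε.le
      linarith
  obtain ⟨k, hk⟩ := exists_nat_ge ((C - l) / (κ * ε))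
  obtain ⟨B, M, hM, hbound⟩ := key k
  rw [div_le_iff₀ hκε] at hk
  rw [max_eq_left (by linarith)] at hbound
  have hη : 0 < ρ / (M + 1) := by positivity
  filter_upwards [hF.eventually_exitCount_le B hη] with n hn
  refine (hbound (F n)).trans ?_
  have hMη : M * (ρ / (M + 1)) ≤ ρ := by
    rw [mul_div_assoc', div_le_iff₀ (by positivity)]
    nlinarith
  have h1 := mul_le_mul_of_nonneg_left hn hM
  have h2 := mul_le_mul_of_nonneg_right hMη (Nat.cast_nonneg (α := ℝ) (F n).card)
  linarith

end OrnsteinWeiss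

section CoverOrder

variable {Y : Type*}

theorem ordOn_le_iff {X : Set Y} {β : Finset (Set Y)} {n : ℕ} :
    ordOn X β ≤ n ↔ ∀ y ∈ X, {U : Set Y | U ∈ β ∧ y ∈ U}.ncard ≤ n + 1 := by
  have hb : BddAbove (Set.range fun y : X => {U : Set Y | U ∈ β ∧ (y : Y) ∈ U}.ncard - 1) := by
    refine ⟨β.card, ?_⟩
    rintro _ ⟨y, rfl⟩
    refine (Nat.sub_le _ _).trans ?_
    rw [← Set.ncard_coe_finset]
    exact Set.ncard_le_ncard (fun U hU => hU.1) β.finite_toSet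
  constructor
  · intro h y hy
    have := (le_ciSup hb ⟨y, hy⟩).trans h
    simp only at this
    omega
  · intro h
    refine ciSup_le' fun y => ?_
    have := h y y.2
    omega

/-- The set where precisely the functions indexed by `S` exceed some positive threshold. -/
def thresholdSet {ι : Type*} (v : ι → Y → NNReal) (S : Finset ι) : Set Y :=
  {y | ∀ a ∈ S, 0 < v a y ∧ ∀ b, b ∉ S → v b y < v a y}

theorem eq_of_mem_thresholdSet {ι : Type*} {v : ι → Y → NNReal} {S T : Finset ι} {y : Y}
    (hS : y ∈ thresholdSet v S) (hT : y ∈ thresholdSet v T) (hcard : S.card = T.card) :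
    S = T := by
  by_contra hne
  have h1 : ¬ S ⊆ T := fun h => hne (Finset.eq_of_subset_of_card_le h hcard.ge)
  have h2 : ¬ T ⊆ S := fun h => hne (Finset.eq_of_subset_of_card_le h hcard.le).symm
  obtain ⟨a, haS, haT⟩ := Finset.not_subset.1 h1
  obtain ⟨b, hbT, hbS⟩ := Finset.not_subset.1 h2
  exact lt_asymm ((hS a haS).2 b hbS) ((hT b hbT).2 a haT)

variable [TopologicalSpace Y]

theorem Dcov_le_ordOn {X : Set Y} {α β : Finset (Set Y)} (hβ : IsOpenCoverOf X β)
    (hβα : ∀ U ∈ β, ∃ V ∈ α, U ⊆ V) : Dcov X α ≤ ordOn X β :=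
  Nat.sInf_le ⟨β, hβ, hβα, rfl⟩

theorem IsOpenCoverOf.exists_ordOn_eq_Dcov {X : Set Y} {α : Finset (Set Y)}
    (hα : IsOpenCoverOf X α) : ∃ β : Finset (Set Y), IsOpenCoverOf X β ∧
      (∀ U ∈ β, ∃ V ∈ α, U ⊆ V) ∧ ordOn X β = Dcov X α :=
  Nat.sInf_mem (s := {n | ∃ β : Finset (Set Y), IsOpenCoverOf X β ∧
    (∀ U ∈ β, ∃ V ∈ α, U ⊆ V) ∧ ordOn X β = n}) ⟨_, α, hα, fun U hU => ⟨U, hU, le_rfl⟩, rfl⟩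

/-- Only the members of a cover that meet `X` matter for `Dcov X`. -/
theorem Dcov_le_of_refines {X : Set Y} {α β : Finset (Set Y)} (hβ : IsOpenCoverOf X β)
    (hβα : ∀ U ∈ β, (U ∩ X).Nonempty → ∃ V ∈ α, U ⊆ V) : Dcov X α ≤ ordOn X β := by
  classical
  refine (Dcov_le_ordOn (β := β.filter fun U => (U ∩ X).Nonempty) ⟨?_, ?_⟩ ?_).trans ?_
  · exact fun U hU => hβ.1 U (Finset.mem_filter.1 hU).1
  · intro x hx
    obtain ⟨U, hU, hxU⟩ := Set.mem_iUnion₂.1 (hβ.2 hx)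
    exact Set.mem_iUnion₂.2 ⟨U, Finset.mem_filter.2 ⟨hU, x, hxU, hx⟩, hxU⟩
  · exact fun U hU => hβα U (Finset.mem_filter.1 hU).1 (Finset.mem_filter.1 hU).2
  · refine ordOn_le_iff.2 fun y hy => le_trans ?_ (ordOn_le_iff.1 (le_refl (ordOn X β)) y hy)
    exact Set.ncard_le_ncard (fun U hU => ⟨(Finset.mem_filter.1 hU.1).1, hU.2⟩)
      (β.finite_toSet.subset fun U hU => hU.1)

theorem IsOpenCoverOf.exists_continuous_subordinate [NormalSpace Y] {X : Set Y} (hX : IsClosed X)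
    {β : Finset (Set Y)} (hβ : IsOpenCoverOf X β) :
    ∃ φ : β → Y → NNReal, (∀ i, Continuous (φ i)) ∧ (∀ i y, 0 < φ i y → y ∈ (i : Set Y)) ∧
      ∀ y ∈ X, ∃ i, 0 < φ i y := by
  obtain ⟨f, hf⟩ := PartitionOfUnity.exists_isSubordinate_of_locallyFinite hX
    (fun i : β => (i : Set Y)) (fun i => hβ.1 i i.2) (locallyFinite_of_finite _) (by
      intro x hx
      obtain ⟨U, hU, hxU⟩ := Set.mem_iUnion₂.1 (hβ.2 hx)
      exact Set.mem_iUnion.2 ⟨⟨U, hU⟩, hxU⟩)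
  refine ⟨fun i y => (f i y).toNNReal, fun i => by fun_prop, fun i y hy => ?_, fun y hy => ?_⟩
  · have : 0 < f i y := Real.toNNReal_pos.1 hy
    exact hf i (subset_tsupport _ this.ne')
  · obtain ⟨i, hi⟩ := f.exists_pos hy
    exact ⟨i, Real.toNNReal_pos.2 hi⟩

theorem isOpen_thresholdSet {ι : Type*} [Finite ι] {v : ι → Y → NNReal}
    (hv : ∀ i, Continuous (v i)) (S : Finset ι) : IsOpen (thresholdSet v S) := by
  have : thresholdSet v S =
      ⋂ a ∈ S, ({y | 0 < v a y} ∩ ⋂ b, ⋂ _ : b ∉ S, {y | v b y < v a y}) := by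
    ext y
    simp [thresholdSet]
  rw [this]
  refine isOpen_biInter_finset fun a _ => (isOpen_lt continuous_const (hv a)).inter ?_
  exact isOpen_iInter_of_finite fun b => isOpen_iInter_of_finite fun _ => isOpen_lt (hv b) (hv a)

theorem exists_common_refinement [NormalSpace Y] {X : Set Y} (hX : IsClosed X)
    {β₁ β₂ : Finset (Set Y)} (h₁ : IsOpenCoverOf X β₁) (h₂ : IsOpenCoverOf X β₂) :
    ∃ β : Finset (Set Y), IsOpenCoverOf X β ∧
      (∀ U ∈ β, (∃ V ∈ β₁, U ⊆ V) ∧ ∃ V ∈ β₂, U ⊆ V) ∧ ordOn X β ≤ ordOn X β₁ + ordOn X β₂ := by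
  classical
  obtain ⟨φ, hφc, hφs, hφX⟩ := h₁.exists_continuous_subordinate hX
  obtain ⟨ψ, hψc, hψs, hψX⟩ := h₂.exists_continuous_subordinate hX
  set Mφ : Y → NNReal := fun y => Finset.univ.sup fun i => φ i y with hMφ
  set Mψ : Y → NNReal := fun y => Finset.univ.sup fun i => ψ i y with hMψ
  have hMφc : Continuous Mφ := Continuous.finset_sup_apply fun i _ => hφc i
  have hMψc : Continuous Mψ := Continuous.finset_sup_apply fun i _ => hψc i
  have hφM : ∀ i y, φ i y ≤ Mφ y := fun i y =>
    Finset.le_sup (f := fun i => φ i y) (Finset.mem_univ i)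
  have hψM : ∀ i y, ψ i y ≤ Mψ y := fun i y =>
    Finset.le_sup (f := fun i => ψ i y) (Finset.mem_univ i)
  set v : β₁ ⊕ β₂ → Y → NNReal :=
    Sum.elim (fun i y => φ i y * Mψ y) (fun j y => Mφ y * ψ j y) with hv
  have hvc : ∀ a, Continuous (v a) := by
    rintro (i | j)
    · exact (hφc i).mul hMψc
    · exact hMφc.mul (hψc j)
  have hvM : ∀ a y, v a y ≤ Mφ y * Mψ y := by
    rintro (i | j) y
    · exact mul_le_mul_left (hφM i y) _
    · exact mul_le_mul_right (hψM j y) _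
  set adm : Finset (Finset (β₁ ⊕ β₂)) :=
    Finset.univ.filter fun S => (∃ i, Sum.inl i ∈ S) ∧ ∃ j, Sum.inr j ∈ S with hadm
  refine ⟨adm.image (thresholdSet v), ⟨?_, ?_⟩, ?_, ?_⟩
  · intro U hU
    obtain ⟨S, -, rfl⟩ := Finset.mem_image.1 hU
    exact isOpen_thresholdSet hvc S
  · intro y hy
    obtain ⟨i₀, hi₀⟩ := hφX y hy
    obtain ⟨j₀, hj₀⟩ := hψX y hy
    have hMpos : 0 < Mφ y * Mψ y :=
      mul_pos (hi₀.trans_le (hφM i₀ y)) (hj₀.trans_le (hψM j₀ y))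
    obtain ⟨i, -, hi⟩ := Finset.exists_mem_eq_sup Finset.univ ⟨i₀, Finset.mem_univ _⟩
      fun i => φ i y
    obtain ⟨j, -, hj⟩ := Finset.exists_mem_eq_sup Finset.univ ⟨j₀, Finset.mem_univ _⟩
      fun j => ψ j y
    refine Set.mem_iUnion₂.2 ⟨thresholdSet v (Finset.univ.filter fun a => v a y = Mφ y * Mψ y),
      Finset.mem_image_of_mem _ ?_, ?_⟩
    · simp only [hadm, Finset.mem_filter, Finset.mem_univ, true_and]
      exact ⟨⟨i, by simp only [hv, Sum.elim_inl, hMφ, hi]⟩,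
        ⟨j, by simp only [hv, Sum.elim_inr, hMψ, hj]⟩⟩
    · intro a ha
      rw [(Finset.mem_filter.1 ha).2]
      refine ⟨hMpos, fun b hb => lt_of_le_of_ne (hvM b y) fun h => hb ?_⟩
      exact Finset.mem_filter.2 ⟨Finset.mem_univ _, h⟩
  · intro U hU
    obtain ⟨S, hS, rfl⟩ := Finset.mem_image.1 hU
    obtain ⟨⟨i, hi⟩, ⟨j, hj⟩⟩ := (Finset.mem_filter.1 hS).2
    exact ⟨⟨i, i.2, fun y hy => hφs i y (pos_of_mul_pos_left (hy _ hi).1 zero_le)⟩,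
      ⟨j, j.2, fun y hy => hψs j y (pos_of_mul_pos_right (hy _ hj).1 zero_le)⟩⟩
  · refine ordOn_le_iff.2 fun y hy => ?_
    have hc₁ := ordOn_le_iff.1 (le_refl (ordOn X β₁)) y hy
    have hc₂ := ordOn_le_iff.1 (le_refl (ordOn X β₂)) y hy
    set A := adm.filter fun S => y ∈ thresholdSet v S with hA
    have hsub : {U : Set Y | U ∈ adm.image (thresholdSet v) ∧ y ∈ U} ⊆
        (A.image (thresholdSet v) : Finset (Set Y)) := by
      rintro U ⟨hU, hyU⟩
      obtain ⟨S, hS, rfl⟩ := Finset.mem_image.1 hU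
      exact Finset.mem_coe.2 (Finset.mem_image_of_mem _ (Finset.mem_filter.2 ⟨hS, hyU⟩))
    set n₁ := {U : Set Y | U ∈ β₁ ∧ y ∈ U}.ncard with hn₁
    set n₂ := {U : Set Y | U ∈ β₂ ∧ y ∈ U}.ncard with hn₂
    have hP : ∀ (β : Finset (Set Y)) (p : β → Prop) [DecidablePred p],
        (∀ i, p i → y ∈ (i : Set Y)) →
        (Finset.univ.filter p).card ≤ {U : Set Y | U ∈ β ∧ y ∈ U}.ncard := by
      intro β p _ hp
      rw [← Finset.card_map (Function.Embedding.subtype _), ← Set.ncard_coe_finset]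
      refine Set.ncard_le_ncard ?_ (β.finite_toSet.subset fun U hU => hU.1)
      intro U hU
      obtain ⟨i, hi, rfl⟩ := Finset.mem_map.1 (Finset.mem_coe.1 hU)
      exact ⟨i.2, hp i (Finset.mem_filter.1 hi).2⟩
    have hcard : ∀ S ∈ A, S.card ∈ Finset.Icc 2 (n₁ + n₂) := by
      intro S hS
      obtain ⟨hS, hyS⟩ := Finset.mem_filter.1 hS
      obtain ⟨⟨i, hi⟩, ⟨j, hj⟩⟩ := (Finset.mem_filter.1 hS).2
      refine Finset.mem_Icc.2 ⟨?_, ?_⟩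
      · exact Finset.one_lt_card.2 ⟨_, hi, _, hj, by simp⟩
      · have hSsub : S ⊆ (Finset.univ.filter fun i => 0 < φ i y).disjSum
            (Finset.univ.filter fun j => 0 < ψ j y) := by
          rintro (i | j) h
          · refine Finset.inl_mem_disjSum.2 (Finset.mem_filter.2 ⟨Finset.mem_univ _, ?_⟩)
            exact pos_of_mul_pos_left (hyS _ h).1 zero_le
          · refine Finset.inr_mem_disjSum.2 (Finset.mem_filter.2 ⟨Finset.mem_univ _, ?_⟩)
            exact pos_of_mul_pos_right (hyS _ h).1 zero_le
        refine (Finset.card_le_card hSsub).trans ?_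
        rw [Finset.card_disjSum]
        exact add_le_add (hP _ _ fun i h => hφs i y h) (hP _ _ fun j h => hψs j y h)
    have hAcard : A.card ≤ (Finset.Icc 2 (n₁ + n₂)).card :=
      Finset.card_le_card_of_injOn Finset.card hcard fun S hS T hT h =>
        eq_of_mem_thresholdSet (Finset.mem_filter.1 hS).2 (Finset.mem_filter.1 hT).2 h
    rw [Nat.card_Icc] at hAcard
    have h1 := Set.ncard_le_ncard hsub (Finset.finite_toSet _)
    rw [Set.ncard_coe_finset] at h1
    have h2 := h1.trans Finset.card_image_le
    omega

theorem Dcov_le_add [NormalSpace Y] {X : Set Y} (hX : IsClosed X) {α α₁ α₂ : Finset (Set Y)}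
    (h₁ : IsOpenCoverOf X α₁) (h₂ : IsOpenCoverOf X α₂)
    (hα : ∀ U : Set Y, (U ∩ X).Nonempty → (∃ V ∈ α₁, U ⊆ V) → (∃ V ∈ α₂, U ⊆ V) →
      ∃ V ∈ α, U ⊆ V) : Dcov X α ≤ Dcov X α₁ + Dcov X α₂ := by
  obtain ⟨β₁, hβ₁, hr₁, ho₁⟩ := h₁.exists_ordOn_eq_Dcov
  obtain ⟨β₂, hβ₂, hr₂, ho₂⟩ := h₂.exists_ordOn_eq_Dcov
  obtain ⟨β, hβ, hr, ho⟩ := exists_common_refinement hX hβ₁ hβ₂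
  rw [← ho₁, ← ho₂]
  refine le_trans (Dcov_le_of_refines hβ fun U hU hne => ?_) ho
  obtain ⟨⟨V₁, hV₁, hUV₁⟩, ⟨V₂, hV₂, hUV₂⟩⟩ := hr U hU
  obtain ⟨W₁, hW₁, hVW₁⟩ := hr₁ V₁ hV₁
  obtain ⟨W₂, hW₂, hVW₂⟩ := hr₂ V₂ hV₂
  exact hα U hne ⟨W₁, hW₁, hUV₁.trans hVW₁⟩ ⟨W₂, hW₂, hUV₂.trans hVW₂⟩

/-- Pulling back covers along a continuous map does not increase `Dcov`. -/
theorem Dcov_le_Dcov_image {Z : Type*} [TopologicalSpace Z] {p : Y → Z} (hp : Continuous p)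
    {X : Set Y} {α : Finset (Set Y)} {γ : Finset (Set Z)} (hγ : IsOpenCoverOf (p '' X) γ)
    (hα : ∀ V ∈ γ, ∃ W ∈ α, p ⁻¹' V ⊆ W) : Dcov X α ≤ Dcov (p '' X) γ := by
  classical
  obtain ⟨β, hβ, hr, ho⟩ := hγ.exists_ordOn_eq_Dcov
  rw [← ho]
  refine (Dcov_le_ordOn (β := β.image fun U => p ⁻¹' U) ⟨?_, ?_⟩ ?_).trans
    (ordOn_le_iff.2 fun y hy => ?_)
  · intro U hU
    obtain ⟨V, hV, rfl⟩ := Finset.mem_image.1 hU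
    exact (hβ.1 V hV).preimage hp
  · intro x hx
    obtain ⟨U, hU, hxU⟩ := Set.mem_iUnion₂.1 (hβ.2 (Set.mem_image_of_mem p hx))
    exact Set.mem_iUnion₂.2 ⟨_, Finset.mem_image_of_mem _ hU, hxU⟩
  · intro U hU
    obtain ⟨U', hU', rfl⟩ := Finset.mem_image.1 hU
    obtain ⟨V, hV, hUV⟩ := hr U' hU'
    obtain ⟨W, hW, hVW⟩ := hα V hV
    exact ⟨W, hW, (Set.preimage_mono hUV).trans hVW⟩
  · have hfin : {U : Set Z | U ∈ β ∧ p y ∈ U}.Finite := β.finite_toSet.subset fun U hU => hU.1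
    refine le_trans ?_ (ordOn_le_iff.1 (le_refl (ordOn (p '' X) β)) _ (Set.mem_image_of_mem p hy))
    refine le_trans (Set.ncard_le_ncard ?_ (hfin.image fun U => p ⁻¹' U)) (Set.ncard_image_le hfin)
    rintro U ⟨hU, hyU⟩
    obtain ⟨V, hV, rfl⟩ := Finset.mem_image.1 hU
    exact ⟨V, ⟨hV, hyU⟩, rfl⟩

end CoverOrder

section FCover

variable {Y H : Type*}

theorem exists_subset_FCover_iff {σ : H → Y → Y} {F : Finset H} {α : Finset (Set Y)} {U : Set Y} :
    (∃ V ∈ FCover σ F α, U ⊆ V) ↔ ∀ g ∈ F, ∃ V ∈ α, U ⊆ σ g ⁻¹' V := by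
  classical
  constructor
  · rintro ⟨V, hV, hUV⟩ g hg
    obtain ⟨f, hf, rfl⟩ := Finset.mem_image.1 hV
    exact ⟨f g hg, Finset.mem_pi.1 hf g hg, fun x hx =>
      Set.mem_iInter₂.1 (hUV hx) g hg⟩
  · intro h
    choose f hf hUf using h
    refine ⟨_, Finset.mem_image_of_mem _ (Finset.mem_pi.2 hf), ?_⟩
    exact Set.subset_iInter₂ hUf

theorem isOpenCoverOf_FCover [TopologicalSpace Y] {σ : H → Y → Y} (hσ : ∀ g, Continuous (σ g)) {X : Set Y}
    (hX : ∀ g, ∀ x ∈ X, σ g x ∈ X) {α : Finset (Set Y)} (hα : IsOpenCoverOf X α)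
    (F : Finset H) : IsOpenCoverOf X (FCover σ F α) := by
  classical
  refine ⟨fun U hU => ?_, fun x hx => ?_⟩
  · obtain ⟨f, hf, rfl⟩ := Finset.mem_image.1 hU
    have : (⋂ g, ⋂ h : g ∈ F, σ g ⁻¹' f g h) = ⋂ g : F, σ g ⁻¹' f g g.2 :=
      (Set.iInter_subtype (fun g => g ∈ F) fun g : F => σ g ⁻¹' f g g.2).symm
    rw [this]
    exact isOpen_iInter_of_finite fun g =>
      (hα.1 _ (Finset.mem_pi.1 hf g g.2)).preimage (hσ g)
  · obtain ⟨V, hV, hxV⟩ := (exists_subset_FCover_iff (σ := σ) (F := F) (α := α) (U := {x})).2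
      fun g _ => by
        obtain ⟨V, hV, hxV⟩ := Set.mem_iUnion₂.1 (hα.2 (hX g x hx))
        exact ⟨V, hV, Set.singleton_subset_iff.2 hxV⟩
    exact Set.mem_iUnion₂.2 ⟨V, hV, Set.singleton_subset_iff.1 hxV⟩

end FCover

section Shift

variable {K : Type*}

open Classical in
/-- The cover of `G → K` obtained by pulling back a cover of `K` along the coordinate `1`. -/
noncomputable def coordCover (G : Type*) [Group G] {K : Type*} (γ : Finset (Set K)) :
    Finset (Set (G → K)) :=
  γ.image fun V => (fun x : G → K => x 1) ⁻¹' V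

theorem exists_subset_FCover_coordCover_iff {F : Finset G} {γ : Finset (Set K)}
    {U : Set (G → K)} :
    (∃ V ∈ FCover (fun c (x : G → K) => shiftAct c x) F (coordCover G γ), U ⊆ V) ↔
      ∀ g ∈ F, ∃ V ∈ γ, ∀ x ∈ U, x g ∈ V := by
  classical
  rw [exists_subset_FCover_iff]
  refine forall₂_congr fun g _ => ?_
  simp [coordCover, Set.subset_def, shiftAct]

theorem continuous_shiftAct [TopologicalSpace K] (c : G) :
    Continuous (fun x : G → K => shiftAct c x) :=
  continuous_pi fun g => continuous_apply (g * c)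

theorem isOpenCoverOf_coordCover [TopologicalSpace K] {γ : Finset (Set K)}
    (hγ : IsOpenCoverOf Set.univ γ) (X : Set (G → K)) : IsOpenCoverOf X (coordCover G γ) := by
  classical
  refine ⟨fun U hU => ?_, fun x _ => ?_⟩
  · obtain ⟨V, hV, rfl⟩ := Finset.mem_image.1 hU
    exact (hγ.1 V hV).preimage (continuous_apply 1)
  · obtain ⟨V, hV, hxV⟩ := Set.mem_iUnion₂.1 (hγ.2 (Set.mem_univ (x 1)))
    exact Set.mem_iUnion₂.2 ⟨_, Finset.mem_image_of_mem _ hV, hxV⟩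

/-- A finite open cover of `G → K` is refined by one depending on finitely many coordinates. -/
theorem exists_coordinates_refining {ι : Type*} [MetricSpace K] [CompactSpace K]
    {α : Finset (Set (ι → K))} (hα : IsOpenCoverOf Set.univ α) :
    ∃ (E : Finset ι) (γ : Finset (Set K)), IsOpenCoverOf Set.univ γ ∧
      ∀ U : Set (ι → K), U.Nonempty → (∀ e ∈ E, ∃ V ∈ γ, ∀ x ∈ U, x e ∈ V) →
        ∃ A ∈ α, U ⊆ A := by
  classical
  obtain ⟨W, hW, hball⟩ := lebesgue_number_lemma (isCompact_univ (X := ι → K))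
    (U := fun A : α => (A : Set (ι → K))) (fun A => hα.1 A A.2) fun x hx => by
      obtain ⟨A, hA, hxA⟩ := Set.mem_iUnion₂.1 (hα.2 hx)
      exact Set.mem_iUnion.2 ⟨⟨A, hA⟩, hxA⟩
  obtain ⟨E, ε, hε, hEW⟩ : ∃ (E : Finset ι) (ε : ℝ), 0 < ε ∧
      ∀ x y : ι → K, (∀ e ∈ E, dist (x e) (y e) < ε) → (x, y) ∈ W := by
    rw [Pi.uniformity, Filter.mem_iInf] at hW
    obtain ⟨I, hI, V, hV, rfl⟩ := hW
    have hdist : ∀ i : I, ∃ δ > 0, ∀ x y : ι → K, dist (x i) (y i) < δ → (x, y) ∈ V i := by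
      intro i
      obtain ⟨t, ht, htV⟩ := Filter.mem_comap.1 (hV i)
      obtain ⟨δ, hδ, hδt⟩ := Metric.mem_uniformity_dist.1 ht
      exact ⟨δ, hδ, fun x y hxy => htV (hδt hxy)⟩
    choose δ hδ hδV using hdist
    have := hI.to_subtype
    obtain ⟨ε, hε, hεδ⟩ : ∃ ε > 0, ∀ i, ε ≤ δ i := by
      cases isEmpty_or_nonempty I
      · exact ⟨1, one_pos, fun i => isEmptyElim i⟩
      · obtain ⟨i, hi⟩ := Finite.exists_min δ
        exact ⟨δ i, hδ i, hi⟩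
    refine ⟨hI.toFinset, ε, hε, fun x y hxy => Set.mem_iInter.2 fun i => hδV i x y ?_⟩
    exact (hxy i (hI.mem_toFinset.2 i.2)).trans_le (hεδ i)
  obtain ⟨t, -, ht⟩ := (isCompact_univ (X := K)).elim_nhds_subcover
    (fun k => Metric.ball k (ε / 2)) fun k _ => Metric.ball_mem_nhds k (half_pos hε)
  refine ⟨E, t.image fun k => Metric.ball k (ε / 2), ⟨fun V hV => ?_, fun k hk => ?_⟩, ?_⟩
  · obtain ⟨k, -, rfl⟩ := Finset.mem_image.1 hV
    exact Metric.isOpen_ball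
  · obtain ⟨c, hc, hkc⟩ := Set.mem_iUnion₂.1 (ht hk)
    exact Set.mem_iUnion₂.2 ⟨_, Finset.mem_image_of_mem _ hc, hkc⟩
  · rintro U ⟨x, hx⟩ hU
    obtain ⟨A, hA⟩ := hball x (Set.mem_univ x)
    refine ⟨A, A.2, fun y hy => hA (hEW x y fun e he => ?_)⟩
    obtain ⟨V, hV, hUV⟩ := hU e he
    obtain ⟨k, -, rfl⟩ := Finset.mem_image.1 hV
    have h1 := Metric.mem_ball.1 (hUV x hx)
    have h2 := Metric.mem_ball'.1 (hUV y hy)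
    linarith [dist_triangle (x e) k (y e)]

/-- The coordinatewise cover by `γ` over the window `F` has `Dcov` at most the dimension of the
projection to `F`. -/
theorem Dcov_FCover_coordCover_le_topDim [TopologicalSpace K] {γ : Finset (Set K)}
    (hγ : IsOpenCoverOf Set.univ γ) (X : Set (G → K)) (F : Finset G) :
    (Dcov X (FCover (fun c (x : G → K) => shiftAct c x) F (coordCover G γ)) : ℕ∞) ≤
      topDim ((fun x (g : ↑F) => x (g : G)) '' X) := by
  classical
  set p : (G → K) → (F → K) := fun x g => x g with hp
  set δ : Finset (Set (F → K)) :=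
    (Fintype.piFinset fun _ : F => γ).image fun f => Set.univ.pi f with hδ
  have hcover : IsOpenCoverOf (p '' X) δ := by
    refine ⟨fun U hU => ?_, fun x _ => ?_⟩
    · obtain ⟨f, hf, rfl⟩ := Finset.mem_image.1 hU
      exact isOpen_set_pi Set.finite_univ fun g _ => hγ.1 _ (Fintype.mem_piFinset.1 hf g)
    · have hx : ∀ g : F, ∃ V ∈ γ, x g ∈ V := fun g => by
        simpa using Set.mem_iUnion₂.1 (hγ.2 (Set.mem_univ (x g)))
      choose f hf hxf using hx
      exact Set.mem_iUnion₂.2 ⟨_, Finset.mem_image_of_mem _ (Fintype.mem_piFinset.2 hf),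
        fun g _ => hxf g⟩
  have hle := Dcov_le_Dcov_image (p := p) (by fun_prop) (X := X)
    (α := FCover (fun c (x : G → K) => shiftAct c x) F (coordCover G γ)) hcover fun V hV => by
      obtain ⟨f, hf, rfl⟩ := Finset.mem_image.1 hV
      exact exists_subset_FCover_coordCover_iff.2 fun g hg =>
        ⟨f ⟨g, hg⟩, Fintype.mem_piFinset.1 hf _, fun x hx => hx ⟨g, hg⟩ (Set.mem_univ _)⟩
  exact (Nat.cast_le.2 hle).trans (le_iSup₂ (f := fun α (_ : α ∈ {α : Finset (Set (F → K)) |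
    IsOpenCoverOf (p '' X) α}) => (Dcov (p '' X) α : ℕ∞)) δ hcover)

theorem Dcov_FCover_coordCover_map_le [TopologicalSpace K] {γ : Finset (Set K)}
    (hγ : IsOpenCoverOf Set.univ γ) {X : Set (G → K)} (hX : ∀ c : G, shiftAct c '' X = X)
    (A : Finset G) (c : G) :
    Dcov X (FCover (fun c (x : G → K) => shiftAct c x) (A.map (mulRightEmbedding c))
        (coordCover G γ)) ≤
      Dcov X (FCover (fun c (x : G → K) => shiftAct c x) A (coordCover G γ)) := by
  have hmem : ∀ g, ∀ x ∈ X, shiftAct g x ∈ X := fun g x hx => hX g ▸ Set.mem_image_of_mem _ hx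
  have hcover := isOpenCoverOf_FCover (σ := fun c (x : G → K) => shiftAct c x)
    continuous_shiftAct hmem (isOpenCoverOf_coordCover hγ X) A
  nth_rw 2 [← hX c]
  rw [← hX c] at hcover
  refine Dcov_le_Dcov_image (continuous_shiftAct c) hcover fun V hV => ?_
  have hV' := exists_subset_FCover_coordCover_iff.1 ⟨V, hV, subset_rfl⟩
  refine exists_subset_FCover_coordCover_iff.2 fun g hg => ?_
  obtain ⟨a, ha, rfl⟩ := Finset.mem_map.1 hg
  obtain ⟨W, hW, hVW⟩ := hV' a ha
  exact ⟨W, hW, fun x hx => hVW _ hx⟩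

theorem Dcov_FCover_empty [TopologicalSpace K] (X : Set (G → K)) (α : Finset (Set (G → K))) :
    Dcov X (FCover (fun c (x : G → K) => shiftAct c x) ∅ α) = 0 := by
  refine Nat.le_zero.1 ((Dcov_le_ordOn (β := {Set.univ}) ⟨?_, ?_⟩ ?_).trans
    (ordOn_le_iff.2 fun y _ => ?_))
  · simp
  · simp
  · exact fun U _ => exists_subset_FCover_iff.2 (by simp)
  · refine (Set.ncard_le_ncard (t := {Set.univ}) ?_).trans (Set.ncard_singleton _).le
    intro U hU
    simpa using hU.1

open Classical in
/-- The join of `α` over `F` depends only on a slightly enlarged window. -/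
theorem exists_Dcov_FCover_le_add [MetricSpace K] [CompactSpace K] {X : Set (G → K)}
    (hXc : IsClosed X) (hX : ∀ c : G, shiftAct c '' X = X) {α : Finset (Set (G → K))}
    (hα : IsOpenCoverOf X α) :
    ∃ (E : Finset G) (γ : Finset (Set K)), IsOpenCoverOf Set.univ γ ∧ ∀ F : Finset G,
      Dcov X (FCover (fun c (x : G → K) => shiftAct c x) F α) ≤
        Dcov X (FCover (fun c (x : G → K) => shiftAct c x) F (coordCover G γ)) +
        Dcov X (FCover (fun c (x : G → K) => shiftAct c x) ((E * F) \ F) (coordCover G γ)) := by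
  have hmem : ∀ g, ∀ x ∈ X, shiftAct g x ∈ X := fun g x hx => hX g ▸ Set.mem_image_of_mem _ hx
  have hα' : IsOpenCoverOf Set.univ (insert Xᶜ α) := by
    refine ⟨fun U hU => ?_, fun x _ => ?_⟩
    · rcases Finset.mem_insert.1 hU with rfl | hU
      · exact hXc.isOpen_compl
      · exact hα.1 U hU
    · by_cases hx : x ∈ X
      · obtain ⟨U, hU, hxU⟩ := Set.mem_iUnion₂.1 (hα.2 hx)
        exact Set.mem_iUnion₂.2 ⟨U, Finset.mem_insert_of_mem hU, hxU⟩
      · exact Set.mem_iUnion₂.2 ⟨_, Finset.mem_insert_self _ _, hx⟩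
  obtain ⟨E, γ, hγ, hEγ⟩ := exists_coordinates_refining hα'
  have hcover := fun F => isOpenCoverOf_FCover (σ := fun c (x : G → K) => shiftAct c x)
    continuous_shiftAct hmem (isOpenCoverOf_coordCover hγ X) F
  refine ⟨E, γ, hγ, fun F => Dcov_le_add hXc (hcover _) (hcover _) fun U hne h₁ h₂ => ?_⟩
  rw [exists_subset_FCover_coordCover_iff] at h₁ h₂
  refine exists_subset_FCover_iff.2 fun g hg => ?_
  obtain ⟨x, hxU, hxX⟩ := hne
  obtain ⟨A, hA, hUA⟩ := hEγ (shiftAct g '' U) ⟨_, Set.mem_image_of_mem _ hxU⟩ fun e he => by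
    have : ∃ V ∈ γ, ∀ y ∈ U, y (e * g) ∈ V := by
      by_cases hF : e * g ∈ F
      · exact h₁ _ hF
      · exact h₂ _ (Finset.mem_sdiff.2 ⟨Finset.mul_mem_mul he hg, hF⟩)
    obtain ⟨V, hV, hUV⟩ := this
    refine ⟨V, hV, ?_⟩
    rintro _ ⟨y, hy, rfl⟩
    exact hUV y hy
  rcases Finset.mem_insert.1 hA with rfl | hA
  · exact absurd (hmem g x hxX) (hUA (Set.mem_image_of_mem _ hxU))
  · exact ⟨A, hA, Set.image_subset_iff.1 hUA⟩

end Shift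

/-- Gromov's upper bound: the mean topological dimension of a
subshift of `K^G` is at most the liminf of normalized dimensions of its finite
projections along any Følner sequence. -/
theorem mdim_upper_bound
    {G : Type*} [Group G] [Countable G] [Infinite G] (hG : IsAmenable G)
    {K : Type*} [MetricSpace K] [CompactSpace K]
    (hdim : topDim (Set.univ : Set K) < ⊤)
    (X : Set (G → K)) (hXc : IsClosed X) (hXinv : ∀ c : G, shiftAct c '' X = X) :
    ∀ Fo : ℕ → Finset G, IsFolnerSeq G Fo →
      mdim (fun c (x : G → K) => shiftAct c x) X Fo ≤
        Filter.liminf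
          (fun n => ENat.toENNReal (topDim ((fun x (g : ↑(Fo n)) => x (g : G)) '' X)) /
            ((Fo n).card : ℝ≥0∞))
          Filter.atTop := by
  classical
  intro Fo hFo
  refine iSup₂_le fun α hα => ?_
  obtain ⟨E, γ, hγ, hE⟩ := exists_Dcov_FCover_le_add hXc hXinv hα
  have hmem : ∀ g, ∀ x ∈ X, shiftAct g x ∈ X := fun g x hx =>
    hXinv g ▸ Set.mem_image_of_mem _ hx
  have hcover := fun F => isOpenCoverOf_FCover (σ := fun c (x : G → K) => shiftAct c x)
    continuous_shiftAct hmem (isOpenCoverOf_coordCover hγ X) F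
  set d : Finset G → ℕ := fun F =>
    Dcov X (FCover (fun c (x : G → K) => shiftAct c x) F (coordCover G γ)) with hd
  have h_empty : d ∅ = 0 := Dcov_FCover_empty X _
  have h_union : ∀ A B, d (A ∪ B) ≤ d A + d B := fun A B =>
    Dcov_le_add hXc (hcover A) (hcover B) fun U _ h₁ h₂ => by
      rw [exists_subset_FCover_iff] at h₁ h₂ ⊢
      exact fun g hg => (Finset.mem_union.1 hg).elim (h₁ g) (h₂ g)
  have h_map : ∀ A c, d (A.map (mulRightEmbedding c)) ≤ d A :=
    Dcov_FCover_coordCover_map_le hγ hXinv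
  have h_card : ∀ A, d A ≤ d {1} * A.card := by
    intro A
    induction A using Finset.induction_on with
    | empty => simp [h_empty]
    | insert a s ha ih =>
      have h1 : d {a} ≤ d {1} := by simpa using h_map {1} a
      have h2 := h_union {a} s
      rw [← Finset.insert_eq] at h2
      rw [Finset.card_insert_of_notMem ha]
      linarith
  refine le_of_forall_gt_imp_ge_of_dense fun b hb => ?_
  obtain ⟨r, hLr, hrb⟩ := ENNReal.lt_iff_exists_nnreal_btwn.1 hb
  obtain ⟨s, hrs, hsb⟩ := ENNReal.lt_iff_exists_nnreal_btwn.1 hrb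
  have hrs' : (r : ℝ) < s := by exact_mod_cast hrs
  have hcardpos : ∀ n, (0 : ℝ) < (Fo n).card := fun n => by exact_mod_cast (hFo.1 n).card_pos
  have hfreq : ∃ᶠ n in atTop, (d (Fo n) : ℝ) ≤ r * (Fo n).card := by
    refine (frequently_lt_of_liminf_lt (by isBoundedDefault) hLr).mono fun n hn => ?_
    have hne : ((Fo n).card : ℝ≥0∞) ≠ 0 := by exact_mod_cast (hFo.1 n).card_pos.ne'
    have h1 := (ENNReal.div_le_iff hne (ENNReal.natCast_ne_top _)).1 hn.le
    have h2 : ((d (Fo n) : ℕ∞) : ℝ≥0∞) ≤ _ :=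
      (ENat.toENNReal_le.2 (Dcov_FCover_coordCover_le_topDim hγ X (Fo n))).trans h1
    rw [ENat.toENNReal_coe] at h2
    have h3 : ((d (Fo n) : NNReal)) ≤ r * ((Fo n).card : NNReal) := by exact_mod_cast h2
    exact_mod_cast h3
  set ρ : ℝ := (s - r) / 4 with hρ
  have hρpos : 0 < ρ := by
    rw [hρ]
    linarith
  have hη : 0 < 2 * ρ / (d {1} + 1) := by positivity
  refine (limsup_le_of_le (by isBoundedDefault) ?_).trans hsb.le
  filter_upwards [hFo.eventually_le_of_frequently_le (h := fun F => (d F : ℝ))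
    (by simp [h_empty]) (fun A B => by exact_mod_cast h_union A B)
    (fun A c => by exact_mod_cast h_map A c) (C := d {1})
    (fun A => by exact_mod_cast h_card A) r.2 hfreq hρpos,
    hFo.eventually_exitCount_le E hη] with n hn hEn
  have h1 : (d ((E * Fo n) \ Fo n) : ℝ) ≤ d {1} * exitCount E (Fo n) := by
    exact_mod_cast (h_card _).trans (Nat.mul_le_mul_left _ (card_mul_sdiff_le_exitCount E (Fo n)))
  have h2 : (d {1} : ℝ) * exitCount E (Fo n) ≤ 2 * ρ * (Fo n).card := by
    refine (mul_le_mul_of_nonneg_left hEn (Nat.cast_nonneg _)).trans ?_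
    rw [← mul_assoc]
    refine mul_le_mul_of_nonneg_right ?_ (Nat.cast_nonneg _)
    rw [mul_div_assoc', div_le_iff₀ (by positivity)]
    linarith
  have h3 : (Dcov X (FCover (fun c (x : G → K) => shiftAct c x) (Fo n) α) : ℝ) ≤
      d (Fo n) + d ((E * Fo n) \ Fo n) := by
    exact_mod_cast hE (Fo n)
  have h4 : (Dcov X (FCover (fun c (x : G → K) => shiftAct c x) (Fo n) α) : ℝ) ≤
      s * (Fo n).card := by
    have hs : (s : ℝ) = r + 2 * ρ + 2 * ρ := by
      rw [hρ]
      ring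
    rw [hs]
    simp only [NNReal.val_eq_coe] at hn
    linarith
  have h5 : (Dcov X (FCover (fun c (x : G → K) => shiftAct c x) (Fo n) α) : NNReal) ≤
      s * ((Fo n).card : NNReal) := by exact_mod_cast h4
  refine ENNReal.div_le_of_le_mul ?_
  exact_mod_cast h5
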